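/- arXiv:1609.09668 — 5 statements merged into one kernel-verified Lean document; each statement's English description precedes it below -/
import Mathlib

section
/- Let A be an n×n matrix over the split quaternion algebra H, let b ∈ H, and let A' be the matrix obtained from A by replacing its i-th row a_{i.} with b·a_{i.} (left multiplication of every entry of the i-th row by b). Then rdet_i A' = b · rdet_i A. -/
/-- The split quaternion (coquaternion) algebra over ℝ:
`i² = −1`, `j² = 1`, `k² = 1`, `ij = −ji = k`. -/
abbrev SplitQuaternion : Type := QuaternionAlgebra ℝ (-1) 0 1

noncomputable section

namespace SplitQuaternion

variable {n : ℕ}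

/-- The ordered product of entries of `A` along the cycle of `σ` containing `s`,
read in the "row" direction:
`a_{s, σ s} * a_{σ s, σ² s} * ⋯ * a_{σ^{L−1} s, s}` where `L` is the cycle length. -/
def rowCycleProd (A : Matrix (Fin n) (Fin n) SplitQuaternion) (σ : Equiv.Perm (Fin n))
    (s : Fin n) : SplitQuaternion :=
  ((List.range (Function.minimalPeriod σ s)).map
    (fun m => A ((σ ^ m) s) ((σ ^ (m + 1)) s))).prod

/-- The ordered product of entries of `A` along the cycle of `σ` containing `s`,
read in the "column" direction:
`a_{s, σ^{L−1} s} * ⋯ * a_{σ² s, σ s} * a_{σ s, s}` where `L` is the cycle length. -/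
def colCycleProd (A : Matrix (Fin n) (Fin n) SplitQuaternion) (σ : Equiv.Perm (Fin n))
    (s : Fin n) : SplitQuaternion :=
  (((List.range (Function.minimalPeriod σ s)).map
    (fun m => A ((σ ^ (m + 1)) s) ((σ ^ m) s))).reverse).prod

open scoped Classical in
/-- The least elements of the cycles of `σ` other than the cycle containing `i`,
listed in increasing order. -/
def otherCycleMins (σ : Equiv.Perm (Fin n)) (i : Fin n) : List (Fin n) :=
  (Finset.univ.filter (fun s : Fin n =>
    (∀ t, σ.SameCycle s t → s ≤ t) ∧ ¬ σ.SameCycle i s)).sort (· ≤ ·)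

/-- The `i`-th row determinant of `A`: the sum over all permutations `σ` of
`(−1)^{n−r}` (which is `sign σ`, `r` being the number of disjoint cycles of `σ`,
fixed points included) times the product of the entries of `A` ordered according to
the left-ordered cycle notation of `σ` whose first cycle starts with `i`, every
other cycle starting with its least element, the cycles being ordered by
increasing least elements. -/
def rdet (A : Matrix (Fin n) (Fin n) SplitQuaternion) (i : Fin n) : SplitQuaternion :=
  ∑ σ : Equiv.Perm (Fin n),
    ((Equiv.Perm.sign σ : ℤ) : SplitQuaternion) *
      (rowCycleProd A σ i * ((otherCycleMins σ i).map (rowCycleProd A σ)).prod)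

/-- The `j`-th column determinant of `A`: the sum over all permutations `τ` of
`(−1)^{n−r}` times the product of the entries of `A` ordered according to the
right-ordered cycle notation of `τ` whose rightmost cycle ends with `j`, every
other cycle ending with its least element, the cycles being ordered (from right
to left) by increasing least elements. -/
def cdet (A : Matrix (Fin n) (Fin n) SplitQuaternion) (j : Fin n) : SplitQuaternion :=
  ∑ σ : Equiv.Perm (Fin n),
    ((Equiv.Perm.sign σ : ℤ) : SplitQuaternion) *
      ((((otherCycleMins σ j).reverse).map (colCycleProd A σ)).prod * colCycleProd A σ j)

/-- The determinant of a Hermitian matrix: the common value of all row and column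
determinants (here given as `rdet` at the index `0`). -/
def hdet [NeZero n] (A : Matrix (Fin n) (Fin n) SplitQuaternion) : SplitQuaternion :=
  rdet A 0

theorem minimalPeriod_perm_pos (σ : Equiv.Perm (Fin n)) (s : Fin n) :
    0 < Function.minimalPeriod σ s := by
  refine Function.IsPeriodicPt.minimalPeriod_pos (orderOf_pos σ) ?_
  rw [Function.IsPeriodicPt, Function.IsFixedPt, Equiv.Perm.iterate_eq_pow, pow_orderOf_eq_one]
  rfl

theorem pow_apply_ne_of_lt_minimalPeriod (σ : Equiv.Perm (Fin n)) (s : Fin n) {m : ℕ}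
    (hm : m ≠ 0) (hlt : m < Function.minimalPeriod σ s) : (σ ^ m) s ≠ s := by
  intro h
  refine Function.not_isPeriodicPt_of_pos_of_lt_minimalPeriod hm hlt ?_
  rw [Function.IsPeriodicPt, Function.IsFixedPt, Equiv.Perm.iterate_eq_pow, h]

theorem rowCycleProd_updateRow_mul_left (A : Matrix (Fin n) (Fin n) SplitQuaternion)
    (i : Fin n) (b : SplitQuaternion) (σ : Equiv.Perm (Fin n)) :
    rowCycleProd (A.updateRow i (fun q => b * A i q)) σ i = b * rowCycleProd A σ i := by
  obtain ⟨L, hL⟩ := Nat.exists_eq_succ_of_ne_zero (minimalPeriod_perm_pos σ i).ne'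
  unfold rowCycleProd
  rw [hL, List.range_succ_eq_map, List.map_cons, List.map_cons, List.prod_cons, List.prod_cons,
    ← mul_assoc, List.map_map, List.map_map]
  congr 1
  · simp
  · congr 1
    refine List.map_congr_left fun m hm => ?_
    have hne : (σ ^ (m + 1)) i ≠ i :=
      pow_apply_ne_of_lt_minimalPeriod σ i m.succ_ne_zero (by
        rw [hL]; exact Nat.succ_lt_succ (List.mem_range.mp hm))
    exact congrFun (Matrix.updateRow_ne hne) _

theorem rowCycleProd_updateRow_of_not_sameCycle (A : Matrix (Fin n) (Fin n) SplitQuaternion)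
    (v : Fin n → SplitQuaternion) {σ : Equiv.Perm (Fin n)} {i s : Fin n}
    (h : ¬ σ.SameCycle i s) :
    rowCycleProd (A.updateRow i v) σ s = rowCycleProd A σ s := by
  unfold rowCycleProd
  congr 1
  refine List.map_congr_left fun m _ => ?_
  have hne : (σ ^ m) s ≠ i := fun hm =>
    h (Equiv.Perm.SameCycle.symm ⟨m, by simpa using hm⟩)
  exact congrFun (Matrix.updateRow_ne hne) _

theorem not_sameCycle_of_mem_otherCycleMins {σ : Equiv.Perm (Fin n)} {i s : Fin n}
    (h : s ∈ otherCycleMins σ i) : ¬ σ.SameCycle i s := by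
  classical
  simp only [otherCycleMins, Finset.mem_sort, Finset.mem_filter] at h
  exact h.2.2

/-- If the `i`-th row of `A` is left-multiplied by `b`, then `rdet_i` is
left-multiplied by `b`. -/
theorem rdet_updateRow_mul_left (A : Matrix (Fin n) (Fin n) SplitQuaternion)
    (i : Fin n) (b : SplitQuaternion) :
    rdet (A.updateRow i (fun q => b * A i q)) i = b * rdet A i := by
  unfold rdet
  rw [Finset.mul_sum]
  refine Finset.sum_congr rfl fun σ _ => ?_
  rw [rowCycleProd_updateRow_mul_left, List.map_congr_left fun s hs =>
    rowCycleProd_updateRow_of_not_sameCycle A _ (not_sameCycle_of_mem_otherCycleMins hs),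
    mul_assoc b, ← mul_assoc, ← mul_assoc b, (Int.cast_commute (Equiv.Perm.sign σ : ℤ) b).eq]

end SplitQuaternion

end
end

section
/- Let A be an n×n matrix over the split quaternion algebra H, let b ∈ H, and let A' be the matrix obtained from A by replacing its j-th column a_{.j} with a_{.j}·b (right multiplication of every entry of the j-th column by b). Then cdet_j A' = (cdet_j A) · b. -/
noncomputable section

namespace SplitQuaternion

variable {n : ℕ}

/-- Along a cycle of `σ` avoiding `j`, changing the `j`-th column does not change the product. -/
theorem colCycleProd_updateCol_of_not_sameCycle (A : Matrix (Fin n) (Fin n) SplitQuaternion)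
    (σ : Equiv.Perm (Fin n)) {j s : Fin n} (v : Fin n → SplitQuaternion) (h : ¬ σ.SameCycle j s) :
    colCycleProd (A.updateCol j v) σ s = colCycleProd A σ s := by
  unfold colCycleProd
  congr 2
  refine List.map_congr_left fun m _ => Matrix.updateCol_ne fun hm => h ?_
  exact Equiv.Perm.SameCycle.symm ⟨m, by simpa using hm⟩

/-- The column cycle product splits off its rightmost factor, the entry `A (σ s) s`. -/
theorem colCycleProd_eq_mul (A : Matrix (Fin n) (Fin n) SplitQuaternion)
    (σ : Equiv.Perm (Fin n)) (s : Fin n) :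
    colCycleProd A σ s =
      ((List.range (Function.minimalPeriod σ s - 1)).map
        (fun m => A ((σ ^ (m + 2)) s) ((σ ^ (m + 1)) s))).reverse.prod * A (σ s) s := by
  have hpos : 0 < Function.minimalPeriod σ s :=
    Function.minimalPeriod_pos_of_mem_periodicPts (σ.injective.mem_periodicPts s)
  obtain ⟨k, hk⟩ := Nat.exists_eq_succ_of_ne_zero hpos.ne'
  simp [colCycleProd, hk, List.range_succ_eq_map, Function.comp_def]

/-- The column cycle product at `j` is right-linear in the `j`-th column. -/
theorem colCycleProd_updateCol_mul_right (A : Matrix (Fin n) (Fin n) SplitQuaternion)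
    (σ : Equiv.Perm (Fin n)) (j : Fin n) (b : SplitQuaternion) :
    colCycleProd (A.updateCol j (fun p => A p j * b)) σ j = colCycleProd A σ j * b := by
  rw [colCycleProd_eq_mul, colCycleProd_eq_mul, Matrix.updateCol_self, mul_assoc]
  congr 3
  refine List.map_congr_left fun m hm => Matrix.updateCol_ne fun h => ?_
  have hlt : m + 1 < Function.minimalPeriod σ j := by
    have := List.mem_range.mp hm
    omega
  refine Function.not_isPeriodicPt_of_pos_of_lt_minimalPeriod m.succ_ne_zero hlt ?_
  rwa [Function.IsPeriodicPt, Function.IsFixedPt, ← Equiv.Perm.coe_pow]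

/-- If the `j`-th column of `A` is right-multiplied by `b`, then `cdet_j` is
right-multiplied by `b`. -/
theorem cdet_updateColumn_mul_right (A : Matrix (Fin n) (Fin n) SplitQuaternion)
    (j : Fin n) (b : SplitQuaternion) :
    cdet (A.updateCol j (fun p => A p j * b)) j = cdet A j * b := by
  unfold cdet
  rw [Finset.sum_mul]
  refine Finset.sum_congr rfl fun σ _ => ?_
  rw [colCycleProd_updateCol_mul_right, mul_assoc, mul_assoc]
  congr 3
  refine List.map_congr_left fun s hs => colCycleProd_updateCol_of_not_sameCycle A σ _ ?_
  simp only [otherCycleMins, List.mem_reverse, Finset.mem_sort, Finset.mem_filter] at hs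
  exact hs.2.2

end SplitQuaternion

end
end

section
/- Let A be an n×n matrix over the split quaternion algebra H and let A* be its conjugate transpose (Hermitian adjoint). Then for every i = 1,…,n, rdet_i (A*) equals the conjugate of cdet_i A. -/
noncomputable section

namespace SplitQuaternion

variable {n : ℕ}

/-- `star` reverses the order of a list product. -/
theorem star_list_prod {R : Type*} [Monoid R] [StarMul R] (l : List R) :
    star l.prod = (l.reverse.map star).prod := by
  induction l with
  | nil => simp
  | cons a l ih => simp [ih]

theorem rowCycleProd_conjTranspose (A : Matrix (Fin n) (Fin n) SplitQuaternion)
    (σ : Equiv.Perm (Fin n)) (s : Fin n) :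
    rowCycleProd A.conjTranspose σ s = star (colCycleProd A σ s) := by
  rw [rowCycleProd, colCycleProd, star_list_prod, List.reverse_reverse, List.map_map]
  rfl

/-- For the conjugate transpose `A*` of `A`, the `i`-th row determinant of `A*`
is the conjugate of the `i`-th column determinant of `A`. -/
theorem rdet_conjTranspose (A : Matrix (Fin n) (Fin n) SplitQuaternion) :
    ∀ i : Fin n, rdet A.conjTranspose i = star (cdet A i) := by
  intro i
  simp only [rdet, cdet, star_sum, star_mul, star_intCast, star_list_prod, List.map_reverse,
    List.reverse_reverse, List.map_map]
  refine Finset.sum_congr rfl fun σ _ => ?_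
  rw [(Int.cast_commute _ _).eq, rowCycleProd_conjTranspose]
  congr 3
  refine List.map_congr_left fun s _ => ?_
  exact rowCycleProd_conjTranspose A σ s

end SplitQuaternion

end
end

section
/- Let A be an n×n matrix over the split quaternion algebra H. Then for every i, the row determinant expands along the i-th row: rdet_i A = Σ_{j=1}^n a_{ij} · R_{ij}, where the right ij-th cofactor R_{ij} is given as follows. If i ≠ j, then R_{ij} = − rdet_k A^{ii}_{.j}(a_{.i}), where A^{ii}_{.j}(a_{.i}) is the (n−1)×(n−1) matrix obtained from A by replacing the j-th column with the i-th column and then deleting both the i-th row and the i-th column, and k = j if i > j, while k = j−1 if i < j. If i = j, then R_{ii} = rdet_k A^{ii}, where A^{ii} is obtained from A by deleting both the i-th row and the i-th column, and k is the least element of {1,…,n} \ {i}. -/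
noncomputable section

namespace SplitQuaternion

variable {n : ℕ}

/-- The right `ij`-th cofactor of `A`: for `i ≠ j` it is `− rdet_k A^{ii}_{.j}(a_{.i})`,
where `A^{ii}_{.j}(a_{.i})` is obtained from `A` by replacing the `j`-th column with the
`i`-th column and deleting both the `i`-th row and column, and `k = j` if `i > j` while
`k = j − 1` if `i < j`; for `i = j` it is `rdet_k A^{ii}` where `k` is the least
remaining index (i.e. position `0` of the submatrix). -/
def cofR (A : Matrix (Fin (n + 1)) (Fin (n + 1)) SplitQuaternion) (i j : Fin (n + 1)) :
    SplitQuaternion :=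
  if hij : i = j then
    if hn : 0 < n then rdet (A.submatrix i.succAbove i.succAbove) ⟨0, hn⟩ else 1
  else
    - rdet ((A.updateCol j (fun p => A p i)).submatrix i.succAbove i.succAbove)
        ⟨if (j : ℕ) < (i : ℕ) then (j : ℕ) else (j : ℕ) - 1, by
          have h1 := i.isLt; have h2 := j.isLt
          have h3 : (i : ℕ) ≠ (j : ℕ) := fun h => hij (Fin.ext h)
          split <;> omega⟩

/-- The left `ij`-th cofactor of `A`: for `i ≠ j` it is `− cdet_k A^{jj}_{i.}(a_{j.})`,
where `A^{jj}_{i.}(a_{j.})` is obtained from `A` by replacing the `i`-th row with the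
`j`-th row and deleting both the `j`-th row and column, and `k = i` if `j > i` while
`k = i − 1` if `j < i`; for `i = j` it is `cdet_k A^{jj}` where `k` is the least
remaining index (i.e. position `0` of the submatrix). -/
def cofL (A : Matrix (Fin (n + 1)) (Fin (n + 1)) SplitQuaternion) (i j : Fin (n + 1)) :
    SplitQuaternion :=
  if hij : i = j then
    if hn : 0 < n then cdet (A.submatrix j.succAbove j.succAbove) ⟨0, hn⟩ else 1
  else
    - cdet ((A.updateRow i (fun q => A j q)).submatrix j.succAbove j.succAbove)
        ⟨if (i : ℕ) < (j : ℕ) then (i : ℕ) else (i : ℕ) - 1, by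
          have h1 := i.isLt; have h2 := j.isLt
          have h3 : (i : ℕ) ≠ (j : ℕ) := fun h => hij (Fin.ext h)
          split <;> omega⟩

open Equiv Function in
/-- A map sending each step of `σ` into a cycle of `τ` sends cycles into cycles. -/
theorem sameCycle_map {α β : Type*} [Finite α] {σ : Perm α} {τ : Perm β} (g : α → β)
    (h : ∀ x, τ.SameCycle (g x) (g (σ x))) {x y : α} (hxy : σ.SameCycle x y) :
    τ.SameCycle (g x) (g y) := by
  obtain ⟨m, rfl⟩ := hxy.exists_nat_pow_eq
  induction m with
  | zero => exact Perm.SameCycle.refl _ _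
  | succ m ih =>
    rw [pow_succ', Perm.mul_apply]
    exact (ih ⟨m, by simp⟩).trans (h _)

theorem pow_apply_of_semiconj_on_cycle {α β : Type*} {σ : Equiv.Perm α} {τ : Equiv.Perm β}
    (f : β → α) {s : β} (h : ∀ p, τ.SameCycle s p → σ (f p) = f (τ p)) (m : ℕ) :
    (σ ^ m) (f s) = f ((τ ^ m) s) := by
  induction m with
  | zero => simp
  | succ m ih =>
    rw [pow_succ', Equiv.Perm.mul_apply, ih, h _ ⟨m, by simp⟩, pow_succ', Equiv.Perm.mul_apply]

theorem minimalPeriod_of_semiconj_on_cycle {α β : Type*} {σ : Equiv.Perm α} {τ : Equiv.Perm β}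
    {f : β → α} (hf : Function.Injective f) {s : β}
    (h : ∀ p, τ.SameCycle s p → σ (f p) = f (τ p)) :
    Function.minimalPeriod σ (f s) = Function.minimalPeriod τ s := by
  rw [Function.minimalPeriod_eq_minimalPeriod_iff]
  intro m
  rw [Function.IsPeriodicPt, Function.IsPeriodicPt, Function.IsFixedPt, Function.IsFixedPt,
    Equiv.Perm.iterate_eq_pow, Equiv.Perm.iterate_eq_pow, pow_apply_of_semiconj_on_cycle f h,
    hf.eq_iff]

theorem rowCycleProd_of_semiconj_on_cycle {m : ℕ}
    (A : Matrix (Fin m) (Fin m) SplitQuaternion) (B : Matrix (Fin n) (Fin n) SplitQuaternion)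
    {σ : Equiv.Perm (Fin m)} {τ : Equiv.Perm (Fin n)} {f : Fin n → Fin m}
    (hf : Function.Injective f) {s : Fin n}
    (h : ∀ p, τ.SameCycle s p → σ (f p) = f (τ p))
    (hAB : ∀ p, τ.SameCycle s p → A (f p) (f (τ p)) = B p (τ p)) :
    rowCycleProd A σ (f s) = rowCycleProd B τ s := by
  unfold rowCycleProd
  rw [minimalPeriod_of_semiconj_on_cycle hf h]
  congr 1
  refine List.map_congr_left fun l _ => ?_
  rw [pow_apply_of_semiconj_on_cycle f h, pow_apply_of_semiconj_on_cycle f h, pow_succ',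
    Equiv.Perm.mul_apply]
  exact hAB _ ⟨l, by simp⟩

/-- The product along a cycle through `i` splits off the first entry; the rest is the product
along the cycle of `k` obtained by short-circuiting `i`. -/
theorem rowCycleProd_of_insert (A : Matrix (Fin (n + 1)) (Fin (n + 1)) SplitQuaternion)
    (B : Matrix (Fin n) (Fin n) SplitQuaternion) {i : Fin (n + 1)} {k : Fin n}
    {σ : Equiv.Perm (Fin (n + 1))} {τ : Equiv.Perm (Fin n)} (hi : σ i = i.succAbove k)
    (hσ : ∀ p, σ (i.succAbove p) = if τ p = k then i else i.succAbove (τ p))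
    (hB : ∀ p, A (i.succAbove p) (σ (i.succAbove p)) = B p (τ p)) :
    rowCycleProd A σ i = A i (i.succAbove k) * rowCycleProd B τ k := by
  have hper : ∀ m, (τ ^ m) k = k ↔ Function.IsPeriodicPt τ m k := fun m => by
    rw [Function.IsPeriodicPt, Function.IsFixedPt, Equiv.Perm.iterate_eq_pow]
  have hpos : 0 < Function.minimalPeriod τ k :=
    Function.minimalPeriod_pos_of_mem_periodicPts (τ.injective.mem_periodicPts k)
  have hpow : ∀ m < Function.minimalPeriod τ k, (σ ^ (m + 1)) i = i.succAbove ((τ ^ m) k) := by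
    intro m
    induction m with
    | zero => simp [hi]
    | succ m ih =>
      intro hm
      rw [pow_succ', Equiv.Perm.mul_apply, ih (by omega), hσ, ← Equiv.Perm.mul_apply, ← pow_succ',
        if_neg]
      rw [hper]
      exact Function.not_isPeriodicPt_of_pos_of_lt_minimalPeriod (by omega) hm
  have hlen : Function.minimalPeriod σ i = Function.minimalPeriod τ k + 1 := by
    apply le_antisymm
    · refine Function.IsPeriodicPt.minimalPeriod_le (by omega) ?_
      obtain ⟨m, hm⟩ := Nat.exists_eq_succ_of_ne_zero hpos.ne'
      rw [Function.IsPeriodicPt, Function.IsFixedPt, Equiv.Perm.iterate_eq_pow, pow_succ', hm,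
        Equiv.Perm.mul_apply, Nat.succ_eq_add_one, hpow m (by omega), hσ, ← Equiv.Perm.mul_apply,
        ← pow_succ', if_pos]
      rw [hper, ← Nat.succ_eq_add_one, ← hm]
      exact Function.isPeriodicPt_minimalPeriod _ _
    · by_contra! hlt
      have hpos' : 0 < Function.minimalPeriod σ i :=
        Function.minimalPeriod_pos_of_mem_periodicPts (σ.injective.mem_periodicPts i)
      obtain ⟨m, hm⟩ := Nat.exists_eq_succ_of_ne_zero hpos'.ne'
      have hfix := Function.isPeriodicPt_minimalPeriod σ i
      rw [Function.IsPeriodicPt, Function.IsFixedPt, Equiv.Perm.iterate_eq_pow, hm,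
        Nat.succ_eq_add_one, hpow m (by omega)] at hfix
      exact Fin.succAbove_ne _ _ hfix
  unfold rowCycleProd
  rw [hlen, List.range_succ_eq_map, List.map_cons, List.prod_cons, List.map_map]
  congr 1
  · simp [hi]
  · congr 1
    refine List.map_congr_left fun m hm => ?_
    rw [List.mem_range] at hm
    rw [Function.comp_apply, Nat.succ_eq_add_one, pow_succ' σ (m + 1), Equiv.Perm.mul_apply,
      hpow m hm, pow_succ' τ m, Equiv.Perm.mul_apply, hB]

theorem rowCycleProd_of_apply_eq_self (A : Matrix (Fin n) (Fin n) SplitQuaternion)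
    {σ : Equiv.Perm (Fin n)} {i : Fin n} (hi : σ i = i) : rowCycleProd A σ i = A i i := by
  have : Function.minimalPeriod σ i = 1 := Function.minimalPeriod_eq_one_iff_isFixedPt.2 hi
  simp [rowCycleProd, this, hi]

open scoped Classical in
/-- The least elements of all the cycles of `τ`, listed in increasing order. -/
def cycleMins (τ : Equiv.Perm (Fin n)) : List (Fin n) :=
  (Finset.univ.filter (fun s : Fin n => ∀ t, τ.SameCycle s t → s ≤ t)).sort (· ≤ ·)

theorem cycleMins_eq_cons (τ : Equiv.Perm (Fin n)) (hn : 0 < n) :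
    cycleMins τ = ⟨0, hn⟩ :: otherCycleMins τ ⟨0, hn⟩ := by
  classical
  unfold cycleMins otherCycleMins
  rw [← Finset.sort_insert]
  · congr 1
    ext s
    simp only [Finset.mem_filter, Finset.mem_univ, true_and, Finset.mem_insert]
    constructor
    · intro h
      by_cases h0 : τ.SameCycle ⟨0, hn⟩ s
      · exact Or.inl (le_antisymm (h _ h0.symm) (Nat.zero_le _))
      · exact Or.inr ⟨h, h0⟩
    · rintro (rfl | h)
      · exact fun t _ => Nat.zero_le _
      · exact h.1
  · exact fun b _ => Nat.zero_le _
  · simp [Equiv.Perm.SameCycle.refl]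

theorem otherCycleMins_eq_map_cycleMins {i : Fin (n + 1)} {σ : Equiv.Perm (Fin (n + 1))}
    {τ : Equiv.Perm (Fin n)} (hi : σ i = i)
    (hσ : ∀ p, σ (i.succAbove p) = i.succAbove (τ p)) :
    otherCycleMins σ i = (cycleMins τ).map i.succAbove := by
  classical
  have hfix : ∀ x, σ.SameCycle i x → x = i := fun x hx =>
    (hx.eq_of_left hi).symm
  have hsc : ∀ s t, σ.SameCycle (i.succAbove s) (i.succAbove t) ↔ τ.SameCycle s t := by
    intro s t
    constructor
    · intro h
      obtain ⟨m, hm⟩ := h.exists_nat_pow_eq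
      rw [pow_apply_of_semiconj_on_cycle i.succAbove (fun p _ => hσ p),
        Fin.succAbove_right_inj] at hm
      exact ⟨m, by simpa using hm⟩
    · exact sameCycle_map i.succAbove fun x => ⟨1, by simp [hσ]⟩
  unfold otherCycleMins cycleMins
  rw [← Fin.coe_succAboveEmb, Finset.map_sort i.succAboveEmb _ (· ≤ ·) (· ≤ ·)
    fun _ _ _ _ => Fin.succAbove_le_succAbove_iff.symm]
  congr 1
  ext x
  refine Fin.succAboveCases i ?_ (fun s => ?_) x
  · simp [Equiv.Perm.SameCycle.refl, Fin.succAbove_ne]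
  · have hne : ¬ σ.SameCycle i (i.succAbove s) := fun h => Fin.succAbove_ne _ _ (hfix _ h)
    have hne' : ¬ σ.SameCycle (i.succAbove s) i := fun h => hne h.symm
    simp [Fin.forall_iff_succAbove i, hne, hne', hsc]

theorem sameCycle_insert_iff {i : Fin (n + 1)} {k : Fin n}
    {σ : Equiv.Perm (Fin (n + 1))} {τ : Equiv.Perm (Fin n)} (hi : σ i = i.succAbove k)
    (hσ : ∀ p, σ (i.succAbove p) = if τ p = k then i else i.succAbove (τ p)) (s t : Fin n) :
    σ.SameCycle (i.succAbove s) (i.succAbove t) ↔ τ.SameCycle s t := by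
  constructor
  · intro h
    have := sameCycle_map (τ := τ) (fun x => Fin.insertNth (α := fun _ => Fin n) i k id x)
      (fun x => ?_) h
    · simpa using this
    · refine Fin.succAboveCases i ?_ (fun p => ?_) x
      · simp [hi, Equiv.Perm.SameCycle.refl]
      · rw [hσ]
        split_ifs with h
        · exact ⟨1, by simp [h]⟩
        · exact ⟨1, by simp⟩
  · refine sameCycle_map i.succAbove fun p => ?_
    by_cases h : τ p = k
    · exact ⟨2, by simp [zpow_ofNat, pow_two, hσ, h, hi]⟩
    · exact ⟨1, by simp [hσ, h]⟩

theorem otherCycleMins_insert {i : Fin (n + 1)} {k : Fin n}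
    {σ : Equiv.Perm (Fin (n + 1))} {τ : Equiv.Perm (Fin n)} (hi : σ i = i.succAbove k)
    (hσ : ∀ p, σ (i.succAbove p) = if τ p = k then i else i.succAbove (τ p)) :
    otherCycleMins σ i = (otherCycleMins τ k).map i.succAbove := by
  classical
  have hsc := sameCycle_insert_iff hi hσ
  have hisc : ∀ s, σ.SameCycle i (i.succAbove s) ↔ τ.SameCycle k s := fun s => by
    rw [← hsc, ← hi, Equiv.Perm.sameCycle_apply_left]
  have hisc' : ∀ s, σ.SameCycle (i.succAbove s) i ↔ τ.SameCycle k s := fun s => by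
    rw [Equiv.Perm.sameCycle_comm, hisc]
  unfold otherCycleMins
  rw [← Fin.coe_succAboveEmb, Finset.map_sort i.succAboveEmb _ (· ≤ ·) (· ≤ ·)
    fun _ _ _ _ => Fin.succAbove_le_succAbove_iff.symm]
  congr 1
  ext x
  refine Fin.succAboveCases i ?_ (fun s => ?_) x
  · simp [Equiv.Perm.SameCycle.refl, Fin.succAbove_ne]
  · simp only [Finset.mem_filter, Finset.mem_univ, true_and, Fin.forall_iff_succAbove i, hisc,
      hisc', hsc, Finset.mem_map, Fin.succAboveEmb_apply, Fin.succAbove_right_inj,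
      exists_eq_right, Fin.succAbove_le_succAbove_iff]
    tauto

/-- The permutation that sends `i` to itself (`none`) or to `i.succAbove k` (`some k`) and
becomes `τ` once `i` is removed from its cycle. -/
def insertPerm (i : Fin (n + 1)) : Option (Fin n) × Equiv.Perm (Fin n) ≃ Equiv.Perm (Fin (n + 1)) :=
  Equiv.Perm.decomposeOption.symm.trans (finSuccEquiv' i).symm.permCongr

theorem insertPerm_none_self (i : Fin (n + 1)) (τ : Equiv.Perm (Fin n)) :
    insertPerm i (none, τ) i = i := by
  simp [insertPerm, Equiv.permCongr_apply]

theorem insertPerm_none_succAbove (i : Fin (n + 1)) (τ : Equiv.Perm (Fin n)) (p : Fin n) :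
    insertPerm i (none, τ) (i.succAbove p) = i.succAbove (τ p) := by
  simp [insertPerm, Equiv.permCongr_apply]

theorem sign_insertPerm_none (i : Fin (n + 1)) (τ : Equiv.Perm (Fin n)) :
    Equiv.Perm.sign (insertPerm i (none, τ)) = Equiv.Perm.sign τ := by
  simp [insertPerm]

theorem insertPerm_some_self (i : Fin (n + 1)) (k : Fin n) (τ : Equiv.Perm (Fin n)) :
    insertPerm i (some k, τ) i = i.succAbove k := by
  simp [insertPerm, Equiv.permCongr_apply]

theorem insertPerm_some_succAbove (i : Fin (n + 1)) (k : Fin n) (τ : Equiv.Perm (Fin n))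
    (p : Fin n) : insertPerm i (some k, τ) (i.succAbove p) =
      if τ p = k then i else i.succAbove (τ p) := by
  split_ifs with h
  · simp [insertPerm, Equiv.permCongr_apply, h]
  · simp [insertPerm, Equiv.permCongr_apply, Equiv.swap_apply_of_ne_of_ne, h]

theorem sign_insertPerm_some (i : Fin (n + 1)) (k : Fin n) (τ : Equiv.Perm (Fin n)) :
    Equiv.Perm.sign (insertPerm i (some k, τ)) = - Equiv.Perm.sign τ := by
  simp [insertPerm]

theorem cofR_self (A : Matrix (Fin (n + 1)) (Fin (n + 1)) SplitQuaternion) (i : Fin (n + 1)) :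
    cofR A i i = ∑ τ : Equiv.Perm (Fin n), ((Equiv.Perm.sign τ : ℤ) : SplitQuaternion) *
      ((cycleMins τ).map (rowCycleProd (A.submatrix i.succAbove i.succAbove) τ)).prod := by
  rcases Nat.eq_zero_or_pos n with rfl | hn
  · simp [cofR, cycleMins]
  · simp [cofR, hn, rdet, cycleMins_eq_cons _ hn]

theorem cofR_succAbove (A : Matrix (Fin (n + 1)) (Fin (n + 1)) SplitQuaternion)
    (i : Fin (n + 1)) (k : Fin n) :
    cofR A i (i.succAbove k) =
      - rdet ((A.updateCol (i.succAbove k) (fun p => A p i)).submatrix i.succAbove i.succAbove)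
        k := by
  rw [cofR, dif_neg (Fin.succAbove_ne i k).symm]
  congr 2
  ext
  by_cases h : k.castSucc < i
  · have h' : (k : ℕ) < i := h
    simp [Fin.succAbove_of_castSucc_lt _ _ h, h']
  · have h' : ¬ (k : ℕ) + 1 < i := fun hk => h (show (k : ℕ) < i by omega)
    simp [Fin.succAbove_of_le_castSucc _ _ (not_lt.1 h), h']

/-- The row determinant expands along the `i`-th row by right cofactors:
`rdet_i A = Σ_j a_{ij} · R_{ij}`. -/
theorem rdet_eq_sum_mul_cofR (A : Matrix (Fin (n + 1)) (Fin (n + 1)) SplitQuaternion)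
    (i : Fin (n + 1)) :
    rdet A i = ∑ j : Fin (n + 1), A i j * cofR A i j := by
  rw [rdet, ← (insertPerm i).sum_comp, Fintype.sum_prod_type, Fintype.sum_option,
    Fin.sum_univ_succAbove _ i]
  congr 1
  · rw [cofR_self, Finset.mul_sum]
    refine Finset.sum_congr rfl fun τ _ => ?_
    rw [sign_insertPerm_none, rowCycleProd_of_apply_eq_self A (insertPerm_none_self i τ),
      otherCycleMins_eq_map_cycleMins (insertPerm_none_self i τ) (insertPerm_none_succAbove i τ),
      List.map_map, ← mul_assoc, ← mul_assoc, (Int.cast_commute _ (A i i)).eq]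
    congr 3
    funext s
    exact rowCycleProd_of_semiconj_on_cycle _ _ Fin.succAbove_right_injective
      (fun p _ => insertPerm_none_succAbove i τ p) fun _ _ => rfl
  · refine Finset.sum_congr rfl fun k _ => ?_
    rw [cofR_succAbove, rdet, ← Finset.sum_neg_distrib, Finset.mul_sum]
    refine Finset.sum_congr rfl fun τ _ => ?_
    have hi := insertPerm_some_self i k τ
    have hσ := insertPerm_some_succAbove i k τ
    rw [sign_insertPerm_some, otherCycleMins_insert hi hσ,
      rowCycleProd_of_insert A ((A.updateCol (i.succAbove k) fun p => A p i).submatrix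
        i.succAbove i.succAbove) hi hσ, List.map_map]
    · have hmap : (otherCycleMins τ k).map
          (rowCycleProd A (insertPerm i (some k, τ)) ∘ i.succAbove) =
          (otherCycleMins τ k).map (rowCycleProd ((A.updateCol (i.succAbove k)
            fun p => A p i).submatrix i.succAbove i.succAbove) τ) := by
        refine List.map_congr_left fun s hs => ?_
        have hs' : ¬ τ.SameCycle k s := by
          simp only [otherCycleMins, Finset.mem_sort, Finset.mem_filter] at hs
          exact hs.2.2
        have hk : ∀ p, τ.SameCycle s p → τ p ≠ k := by
          rintro p hp rfl
          exact hs' (Equiv.Perm.sameCycle_apply_left.2 hp.symm)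
        exact rowCycleProd_of_semiconj_on_cycle _ _ Fin.succAbove_right_injective
          (fun p hp => by rw [hσ, if_neg (hk p hp)])
          fun p hp => by simp [hk p hp]
      rw [hmap, Units.val_neg, Int.cast_neg, neg_mul, mul_neg, mul_assoc (A i _), ← mul_assoc,
        ← mul_assoc (A i _), (Int.cast_commute _ (A i _)).eq]
    · intro p
      rw [hσ]
      split_ifs with h <;> simp [h]

end SplitQuaternion

end
end

section
/- Let A be a Hermitian n×n matrix over the split quaternion algebra H and let A_{.i}(a_{.j}) denote the matrix obtained from A by replacing its i-th column with its j-th column. Then for all i, j with i ≠ j, cdet_i A_{.i}(a_{.j}) = 0. -/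
noncomputable section

namespace SplitQuaternion

variable {n : ℕ}

open Equiv Equiv.Perm Function

section Permutations

variable {α : Type*}

theorem pow_apply_eq_of_agree {σ τ : Perm α} {s : α}
    (h : ∀ k : ℕ, τ ((σ ^ k) s) = σ ((σ ^ k) s)) (k : ℕ) : (τ ^ k) s = (σ ^ k) s := by
  induction k with
  | zero => rfl
  | succ k ih => rw [pow_succ', pow_succ', Perm.mul_apply, Perm.mul_apply, ih, h]

theorem minimalPeriod_eq_of_pow_apply_eq {σ τ : Perm α} {s : α}
    (h : ∀ k : ℕ, (τ ^ k) s = (σ ^ k) s) : minimalPeriod τ s = minimalPeriod σ s := by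
  rw [minimalPeriod_eq_minimalPeriod_iff]
  intro k
  simp only [IsPeriodicPt, IsFixedPt, iterate_eq_pow, h]

theorem sameCycle_iff_of_pow_apply_eq [Finite α] {σ τ : Perm α} {s : α}
    (h : ∀ k : ℕ, (τ ^ k) s = (σ ^ k) s) (t : α) : τ.SameCycle s t ↔ σ.SameCycle s t := by
  constructor
  · intro hst
    obtain ⟨k, rfl⟩ := hst.exists_nat_pow_eq
    exact ⟨k, by simp [h]⟩
  · intro hst
    obtain ⟨k, rfl⟩ := hst.exists_nat_pow_eq
    exact ⟨k, by simp [h]⟩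

theorem pow_minimalPeriod_apply (σ : Perm α) (s : α) : (σ ^ minimalPeriod σ s) s = s := by
  rw [← iterate_eq_pow, iterate_minimalPeriod]

theorem minimalPeriod_perm_pos_s10 [Finite α] (σ : Perm α) (s : α) : 0 < minimalPeriod σ s :=
  minimalPeriod_pos_of_mem_periodicPts (σ.injective.mem_periodicPts s)

theorem pow_apply_ne_of_lt_minimalPeriod_s10 {σ : Perm α} {s : α} {k : ℕ} (hk : 0 < k)
    (hk' : k < minimalPeriod σ s) : (σ ^ k) s ≠ s := fun h =>
  not_isPeriodicPt_of_pos_of_lt_minimalPeriod hk.ne' hk' (by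
    rwa [IsPeriodicPt, IsFixedPt, iterate_eq_pow])

variable [DecidableEq α]

theorem mul_swap_apply_eq_of_not_sameCycle {σ : Perm α} {i j x : α} (hi : ¬σ.SameCycle i x)
    (hj : ¬σ.SameCycle j x) (k : ℕ) : ((σ * swap i j) ^ k) x = (σ ^ k) x := by
  refine pow_apply_eq_of_agree (fun k => ?_) k
  rw [Perm.mul_apply, swap_apply_of_ne_of_ne]
  · rintro rfl
    exact hi (sameCycle_pow_left.2 (SameCycle.refl _ _))
  · rintro rfl
    exact hj (sameCycle_pow_left.2 (SameCycle.refl _ _))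

theorem sameCycle_mul_swap_iff_of_not_sameCycle [Finite α] {σ : Perm α} {i j x : α}
    (hi : ¬σ.SameCycle i x) (hj : ¬σ.SameCycle j x) (t : α) :
    (σ * swap i j).SameCycle x t ↔ σ.SameCycle x t :=
  sameCycle_iff_of_pow_apply_eq (mul_swap_apply_eq_of_not_sameCycle hi hj) t

theorem sameCycle_or_mul_swap [Finite α] (σ : Perm α) (i j x : α) :
    ((σ * swap i j).SameCycle i x ∨ (σ * swap i j).SameCycle j x) ↔
      (σ.SameCycle i x ∨ σ.SameCycle j x) := by
  have key : ∀ τ : Perm α, ¬ (τ.SameCycle i x ∨ τ.SameCycle j x) →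
      ¬ ((τ * swap i j).SameCycle i x ∨ (τ * swap i j).SameCycle j x) := by
    intro τ h
    rw [not_or] at h
    rw [sameCycle_comm, sameCycle_comm (x := j),
      sameCycle_mul_swap_iff_of_not_sameCycle h.1 h.2,
      sameCycle_mul_swap_iff_of_not_sameCycle h.1 h.2, sameCycle_comm, sameCycle_comm (y := j)]
    tauto
  constructor
  · contrapose
    exact key σ
  · contrapose
    intro h
    simpa [mul_assoc] using key _ h

theorem mul_swap_pow_apply [Finite α] {σ : Perm α} {i j : α} (h : ¬σ.SameCycle i j) {k : ℕ}
    (hk : k < minimalPeriod σ j) : ((σ * swap i j) ^ (k + 1)) i = (σ ^ (k + 1)) j := by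
  induction k with
  | zero => simp
  | succ k ih =>
    rw [pow_succ', Perm.mul_apply, ih (by omega), pow_succ' σ (k + 1), Perm.mul_apply,
      Perm.mul_apply, swap_apply_of_ne_of_ne]
    · intro e
      exact h (SameCycle.symm ⟨(k + 1 : ℕ), by rw [zpow_natCast, e]⟩)
    · exact pow_apply_ne_of_lt_minimalPeriod_s10 (by omega) hk

theorem mul_swap_pow_minimalPeriod_apply [Finite α] {σ : Perm α} {i j : α}
    (h : ¬σ.SameCycle i j) : ((σ * swap i j) ^ minimalPeriod σ j) i = j := by
  have hp := minimalPeriod_perm_pos_s10 σ j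
  have := mul_swap_pow_apply h (k := minimalPeriod σ j - 1) (by omega)
  rwa [Nat.sub_add_cancel hp, pow_minimalPeriod_apply] at this

theorem sameCycle_mul_swap [Finite α] {σ : Perm α} {i j : α} (h : ¬σ.SameCycle i j) :
    (σ * swap i j).SameCycle i j :=
  ⟨minimalPeriod σ j, by rw [zpow_natCast, mul_swap_pow_minimalPeriod_apply h]⟩

theorem minimalPeriod_mul_swap [Finite α] {σ : Perm α} {i j : α} (h : ¬σ.SameCycle i j) :
    minimalPeriod (σ * swap i j) i = minimalPeriod σ i + minimalPeriod σ j := by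
  have h' : ¬σ.SameCycle j i := fun e => h e.symm
  have hi := minimalPeriod_perm_pos_s10 σ i
  have hpos := minimalPeriod_perm_pos_s10 (σ * swap i j) i
  apply le_antisymm
  · refine IsPeriodicPt.minimalPeriod_le (by omega) ?_
    rw [IsPeriodicPt, IsFixedPt, iterate_eq_pow, pow_add, Perm.mul_apply,
      mul_swap_pow_minimalPeriod_apply h, swap_comm, mul_swap_pow_minimalPeriod_apply h']
  · by_contra! hlt
    have hp := pow_minimalPeriod_apply (σ * swap i j) i
    obtain ⟨q, hq⟩ := Nat.exists_eq_add_of_lt hpos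
    rw [zero_add] at hq
    rw [hq] at hp hlt
    by_cases hqj : q < minimalPeriod σ j
    · rw [mul_swap_pow_apply h hqj] at hp
      exact h' ⟨(q + 1 : ℕ), by rw [zpow_natCast, hp]⟩
    · obtain ⟨r, rfl⟩ := Nat.exists_eq_add_of_le (not_lt.1 hqj)
      rw [show minimalPeriod σ j + r + 1 = (r + 1) + minimalPeriod σ j by omega, pow_add,
        Perm.mul_apply, mul_swap_pow_minimalPeriod_apply h, swap_comm,
        mul_swap_pow_apply h' (by omega)] at hp
      exact pow_apply_ne_of_lt_minimalPeriod_s10 (by omega) (by omega) hp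

theorem not_sameCycle_mul_swap [Finite α] {σ : Perm α} {i j : α} (hij : i ≠ j)
    (h : σ.SameCycle i j) : ¬(σ * swap i j).SameCycle i j := by
  classical
  have hex := h.exists_nat_pow_eq
  set p := Nat.find hex
  have hpj : (σ ^ p) i = j := Nat.find_spec hex
  have hmin : ∀ m < p, (σ ^ m) i ≠ j := fun m hm => Nat.find_min hex hm
  have hp0 : 0 < p := Nat.pos_of_ne_zero fun h0 => hij (by simpa [h0] using hpj)
  have hne : ∀ m, 0 < m → m ≤ p → (σ ^ m) i ≠ i := by
    intro m hm hmp e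
    refine hmin (p - m) (by omega) ?_
    rw [← hpj]
    conv_rhs => rw [← Nat.sub_add_cancel hmp, pow_add, Perm.mul_apply, e]
  have hpow : ∀ m < p, ((σ * swap i j) ^ (m + 1)) j = (σ ^ (m + 1)) i := by
    intro m hm
    induction m with
    | zero => simp
    | succ m ih =>
      rw [pow_succ', Perm.mul_apply, ih (by omega), pow_succ' σ (m + 1), Perm.mul_apply,
        Perm.mul_apply, swap_apply_of_ne_of_ne (hne _ (by omega) (by omega)) (hmin _ hm)]
  have hper : IsPeriodicPt (σ * swap i j) p j := by
    have := hpow (p - 1) (by omega)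
    rw [Nat.sub_add_cancel hp0, hpj] at this
    rwa [IsPeriodicPt, IsFixedPt, iterate_eq_pow]
  intro hs
  obtain ⟨k, hk⟩ := hs.symm.exists_nat_pow_eq
  rw [← iterate_eq_pow, ← hper.iterate_mod_apply, iterate_eq_pow] at hk
  have hlt := Nat.mod_lt k hp0
  rcases Nat.eq_zero_or_pos (k % p) with h0 | h0
  · rw [h0] at hk
    exact hij hk.symm
  · obtain ⟨q, hq⟩ := Nat.exists_eq_add_of_lt h0
    rw [zero_add] at hq
    rw [hq] at hk hlt
    rw [hpow q (by omega)] at hk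
    exact hne _ (by omega) (by omega) hk

open scoped Classical in
/-- The permutation obtained from `σ` by inverting its cycle through `j`. -/
def invCycle [Fintype α] (j : α) (σ : Perm α) : Perm α :=
  σ * (σ.cycleOf j)⁻¹ ^ 2

theorem invCycle_apply_of_sameCycle [Fintype α] {σ : Perm α} {j x : α} (h : σ.SameCycle j x) :
    invCycle j σ x = σ⁻¹ x := by
  classical
  have h1 : σ⁻¹.SameCycle j x := sameCycle_inv.2 h
  have h2 : σ⁻¹.SameCycle j (σ⁻¹ x) := sameCycle_apply_right.2 h1
  simp only [invCycle, cycleOf_inv, pow_two, Perm.mul_apply]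
  rw [h1.cycleOf_apply, h2.cycleOf_apply, ← Perm.mul_apply σ, mul_inv_cancel, Perm.one_apply]

theorem invCycle_apply_of_not_sameCycle [Fintype α] {σ : Perm α} {j x : α}
    (h : ¬σ.SameCycle j x) : invCycle j σ x = σ x := by
  classical
  have h1 : ¬σ⁻¹.SameCycle j x := fun e => h (sameCycle_inv.1 e)
  simp only [invCycle, cycleOf_inv, pow_two, Perm.mul_apply]
  rw [cycleOf_apply_of_not_sameCycle h1, cycleOf_apply_of_not_sameCycle h1]

theorem invCycle_pow_apply_of_sameCycle [Fintype α] {σ : Perm α} {j x : α}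
    (h : σ.SameCycle j x) (k : ℕ) : (invCycle j σ ^ k) x = (σ⁻¹ ^ k) x := by
  refine pow_apply_eq_of_agree (fun k => invCycle_apply_of_sameCycle ?_) k
  exact sameCycle_inv.1 (sameCycle_pow_right.2 (sameCycle_inv.2 h))

theorem invCycle_pow_apply_of_not_sameCycle [Fintype α] {σ : Perm α} {j x : α}
    (h : ¬σ.SameCycle j x) (k : ℕ) : (invCycle j σ ^ k) x = (σ ^ k) x := by
  refine pow_apply_eq_of_agree (fun k => invCycle_apply_of_not_sameCycle ?_) k
  rwa [sameCycle_pow_right]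

theorem sameCycle_invCycle [Fintype α] {σ : Perm α} {j x t : α} :
    (invCycle j σ).SameCycle x t ↔ σ.SameCycle x t := by
  by_cases h : σ.SameCycle j x
  · rw [sameCycle_iff_of_pow_apply_eq (invCycle_pow_apply_of_sameCycle h), sameCycle_inv]
  · exact sameCycle_iff_of_pow_apply_eq (invCycle_pow_apply_of_not_sameCycle h) t

theorem inv_invCycle_apply [Fintype α] {σ : Perm α} {j x : α} (h : σ.SameCycle j x) :
    (invCycle j σ)⁻¹ x = σ x := by
  rw [Perm.inv_eq_iff_eq, invCycle_apply_of_sameCycle (sameCycle_apply_right.2 h),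
    ← Perm.mul_apply, inv_mul_cancel, Perm.one_apply]

theorem invCycle_invCycle [Fintype α] (σ : Perm α) (j : α) :
    invCycle j (invCycle j σ) = σ := by
  ext x
  by_cases h : σ.SameCycle j x
  · rw [invCycle_apply_of_sameCycle (sameCycle_invCycle.2 h), inv_invCycle_apply h]
  · rw [invCycle_apply_of_not_sameCycle (mt sameCycle_invCycle.1 h),
      invCycle_apply_of_not_sameCycle h]

theorem sign_invCycle [Fintype α] (σ : Perm α) (j : α) : sign (invCycle j σ) = sign σ := by
  simp [invCycle]

end Permutations

section CycleProducts

/-- The ordered product of the entries of `A` along the first `k` steps of the orbit of `s`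
under `σ`, read from right to left. -/
def pathProd (A : Matrix (Fin n) (Fin n) SplitQuaternion) (σ : Perm (Fin n)) (s : Fin n)
    (k : ℕ) : SplitQuaternion :=
  ((List.range k).map (fun m => A ((σ ^ (m + 1)) s) ((σ ^ m) s))).reverse.prod

variable {A : Matrix (Fin n) (Fin n) SplitQuaternion} {σ τ : Perm (Fin n)} {s : Fin n}

theorem colCycleProd_eq_pathProd : colCycleProd A σ s = pathProd A σ s (minimalPeriod σ s) :=
  rfl

theorem pathProd_zero : pathProd A σ s 0 = 1 := rfl

theorem pathProd_succ (k : ℕ) :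
    pathProd A σ s (k + 1) = A ((σ ^ (k + 1)) s) ((σ ^ k) s) * pathProd A σ s k := by
  simp [pathProd, List.range_succ]

theorem pathProd_add (k l : ℕ) :
    pathProd A σ s (k + l) = pathProd A σ ((σ ^ l) s) k * pathProd A σ s l := by
  induction k with
  | zero => simp [pathProd_zero]
  | succ k ih =>
    rw [Nat.add_right_comm, pathProd_succ, ih, pathProd_succ, mul_assoc, ← Perm.mul_apply,
      ← Perm.mul_apply, ← pow_add, ← pow_add, Nat.add_right_comm]

theorem pathProd_congr {B : Matrix (Fin n) (Fin n) SplitQuaternion} {t : Fin n} {k : ℕ}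
    (h : ∀ m < k, B ((τ ^ (m + 1)) t) ((τ ^ m) t) = A ((σ ^ (m + 1)) s) ((σ ^ m) s)) :
    pathProd B τ t k = pathProd A σ s k := by
  unfold pathProd
  congr 2
  exact List.map_congr_left fun m hm => h m (List.mem_range.1 hm)

theorem colCycleProd_congr (h : ∀ k : ℕ, (τ ^ k) s = (σ ^ k) s) :
    colCycleProd A τ s = colCycleProd A σ s := by
  rw [colCycleProd_eq_pathProd, colCycleProd_eq_pathProd, minimalPeriod_eq_of_pow_apply_eq h]
  exact pathProd_congr fun m _ => by rw [h, h]

theorem colCycleProd_mul_swap {i j : Fin n} (h : ¬σ.SameCycle i j) (hA : ∀ p, A p i = A p j) :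
    colCycleProd A (σ * swap i j) i = colCycleProd A σ i * colCycleProd A σ j := by
  have h' : ¬σ.SameCycle j i := fun e => h e.symm
  have key : ∀ {a b : Fin n}, ¬σ.SameCycle a b → (∀ p, A p a = A p b) →
      pathProd A (σ * swap a b) a (minimalPeriod σ b) = pathProd A σ b (minimalPeriod σ b) := by
    intro a b hab hA
    refine pathProd_congr fun m hm => ?_
    rw [mul_swap_pow_apply hab hm]
    cases m with
    | zero => exact hA _
    | succ m => rw [mul_swap_pow_apply hab (by omega)]
  rw [colCycleProd_eq_pathProd, minimalPeriod_mul_swap h, pathProd_add,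
    mul_swap_pow_minimalPeriod_apply h, key h hA, swap_comm, key h' fun p => (hA p).symm]
  rfl

theorem re_mul_comm (x y : SplitQuaternion) : (x * y).re = (y * x).re := by
  simp only [QuaternionAlgebra.re_mul]
  ring

theorem re_colCycleProd_apply (A : Matrix (Fin n) (Fin n) SplitQuaternion) (σ : Perm (Fin n))
    (s : Fin n) : (colCycleProd A σ (σ s)).re = (colCycleProd A σ s).re := by
  obtain ⟨q, hq⟩ := Nat.exists_eq_add_of_lt (minimalPeriod_perm_pos_s10 σ s)
  rw [zero_add] at hq
  have hs : (σ ^ (q + 1)) s = s := hq ▸ pow_minimalPeriod_apply σ s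
  have hs' : (σ ^ q) (σ s) = s := by rw [← Perm.mul_apply, ← pow_succ, hs]
  rw [colCycleProd_eq_pathProd, colCycleProd_eq_pathProd,
    minimalPeriod_apply (σ.injective.mem_periodicPts s), hq, pathProd_succ, pathProd_add,
    pow_succ' σ q, Perm.mul_apply, hs', re_mul_comm]
  simp [pathProd_succ, pathProd_zero]

theorem re_colCycleProd_eq_of_sameCycle {t : Fin n} (h : σ.SameCycle s t) :
    (colCycleProd A σ t).re = (colCycleProd A σ s).re := by
  obtain ⟨k, rfl⟩ := h.exists_nat_pow_eq
  clear h
  induction k with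
  | zero => rfl
  | succ k ih => rw [pow_succ', Perm.mul_apply, re_colCycleProd_apply, ih]

theorem colCycleProd_inv (hA : ∀ k : ℕ, star (A ((σ ^ (k + 1)) s) ((σ ^ k) s)) =
    A ((σ ^ k) s) ((σ ^ (k + 1)) s)) :
    colCycleProd A σ⁻¹ s = star (colCycleProd A σ s) := by
  have hL : minimalPeriod (σ⁻¹ : Perm (Fin n)) s = minimalPeriod σ s := by
    rw [minimalPeriod_eq_minimalPeriod_iff]
    intro k
    simp only [IsPeriodicPt, IsFixedPt, iterate_eq_pow, inv_pow, Perm.inv_eq_iff_eq]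
    exact eq_comm
  have key : ∀ k ≤ minimalPeriod σ s,
      pathProd A σ⁻¹ ((σ ^ k) s) k = star (pathProd A σ s k) := by
    intro k
    induction k with
    | zero => simp [pathProd_zero]
    | succ k ih =>
      intro hk
      have e : (σ⁻¹ : Perm (Fin n)) ((σ ^ (k + 1)) s) = (σ ^ k) s := by
        rw [← Perm.mul_apply, pow_succ', inv_mul_cancel_left]
      rw [pathProd_add, pathProd_succ, pathProd_zero, pathProd_succ, star_mul, hA,
        ← ih (by omega)]
      simp [e]
  rw [colCycleProd_eq_pathProd, colCycleProd_eq_pathProd, hL, ← key _ le_rfl,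
    pow_minimalPeriod_apply]

theorem add_star_eq_coe_re (x : SplitQuaternion) :
    x + star x = ((2 * x.re : ℝ) : SplitQuaternion) := by
  rw [QuaternionAlgebra.self_add_star', zero_mul, add_zero]

end CycleProducts

theorem mem_otherCycleMins {σ : Perm (Fin n)} {i s : Fin n} :
    s ∈ otherCycleMins σ i ↔ (∀ t, σ.SameCycle s t → s ≤ t) ∧ ¬σ.SameCycle i s := by
  simp [otherCycleMins]

theorem otherCycleMins_eq_erase {σ τ : Perm (Fin n)} {i j m : Fin n}
    (h : ∀ s, s ∈ otherCycleMins τ j ↔ s ∈ otherCycleMins σ i ∧ s ≠ m) :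
    otherCycleMins τ j = (otherCycleMins σ i).erase m := by
  have hσ : (otherCycleMins σ i).Nodup := Finset.sort_nodup _ _
  refine List.Perm.eq_of_pairwise' (r := (· ≤ ·)) (Finset.pairwise_sort _ _)
    ((Finset.pairwise_sort _ _).sublist List.erase_sublist)
    ((List.perm_ext_iff_of_nodup (Finset.sort_nodup _ _) (hσ.erase _)).2 fun s => ?_)
  rw [hσ.mem_erase_iff, and_comm, ← h, otherCycleMins]

theorem prod_reverse_map_add_of_mem {R ι : Type*} [Ring R] [DecidableEq ι] {l : List ι}
    {m : ι} (hm : m ∈ l) (hl : l.Nodup) {F G : ι → R} {c : R} (hc : ∀ x, Commute c x)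
    (hFG : ∀ s ∈ l, s ≠ m → G s = F s) (hFGm : F m + G m = c) :
    (l.reverse.map F).prod + (l.reverse.map G).prod = ((l.erase m).reverse.map F).prod * c := by
  obtain ⟨l₁, l₂, hm₁, rfl, he⟩ := List.exists_erase_eq hm
  have hm₂ : m ∉ l₂ := by
    rw [List.nodup_append] at hl
    exact (List.nodup_cons.1 hl.2.1).1
  have h₁ : l₁.reverse.map G = l₁.reverse.map F := List.map_congr_left fun s hs => by
    rw [List.mem_reverse] at hs
    exact hFG s (by simp [hs]) (by rintro rfl; exact hm₁ hs)
  have h₂ : l₂.reverse.map G = l₂.reverse.map F := List.map_congr_left fun s hs => by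
    rw [List.mem_reverse] at hs
    exact hFG s (by simp [hs]) (by rintro rfl; exact hm₂ hs)
  rw [he]
  simp only [List.reverse_append, List.reverse_cons, List.map_append, List.prod_append, h₁, h₂,
    List.map_cons, List.map_nil, List.prod_cons, List.prod_nil, mul_one]
  rw [← add_mul, ← mul_add, hFGm, mul_assoc, (hc _).eq, mul_assoc]

/-- The unsigned term of `cdet A i` indexed by `σ`. -/
def cdetTerm (A : Matrix (Fin n) (Fin n) SplitQuaternion) (i : Fin n) (σ : Perm (Fin n)) :
    SplitQuaternion :=
  ((otherCycleMins σ i).reverse.map (colCycleProd A σ)).prod * colCycleProd A σ i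

section Cancellation

variable {B : Matrix (Fin n) (Fin n) SplitQuaternion} {i j : Fin n} {σ : Perm (Fin n)}

theorem exists_cycle_min (σ : Perm (Fin n)) (j : Fin n) :
    ∃ m, σ.SameCycle j m ∧ ∀ t, σ.SameCycle m t → m ≤ t := by
  classical
  obtain ⟨m, hm, hmin⟩ := Finset.exists_min_image
    (Finset.univ.filter fun t => σ.SameCycle j t) id ⟨j, by simp [SameCycle.refl]⟩
  simp only [Finset.mem_filter, Finset.mem_univ, true_and, id] at hm hmin
  exact ⟨m, hm, fun t ht => hmin t (hm.trans ht)⟩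

theorem mem_otherCycleMins_mul_swap (h : ¬σ.SameCycle i j) {s : Fin n} :
    s ∈ otherCycleMins (σ * swap i j) i ↔ s ∈ otherCycleMins σ i ∧ ¬σ.SameCycle j s := by
  have hs : (σ * swap i j).SameCycle i s ↔ (σ.SameCycle i s ∨ σ.SameCycle j s) := by
    rw [← sameCycle_or_mul_swap]
    exact ⟨Or.inl, fun e => e.elim id (sameCycle_mul_swap h).trans⟩
  rw [mem_otherCycleMins, mem_otherCycleMins, hs, not_or]
  constructor
  · rintro ⟨h1, h2, h3⟩
    simp only [sameCycle_mul_swap_iff_of_not_sameCycle h2 h3] at h1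
    exact ⟨⟨h1, h2⟩, h3⟩
  · rintro ⟨⟨h1, h2⟩, h3⟩
    simp only [sameCycle_mul_swap_iff_of_not_sameCycle h2 h3]
    exact ⟨h1, h2, h3⟩

theorem otherCycleMins_mul_swap (h : ¬σ.SameCycle i j) {m : Fin n} (hjm : σ.SameCycle j m)
    (hm : ∀ t, σ.SameCycle m t → m ≤ t) :
    otherCycleMins (σ * swap i j) i = (otherCycleMins σ i).erase m := by
  refine otherCycleMins_eq_erase fun s => ?_
  rw [mem_otherCycleMins_mul_swap h]
  refine and_congr_right fun hs => not_congr ⟨fun hjs => ?_, ?_⟩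
  · have hms := hjm.symm.trans hjs
    exact le_antisymm ((mem_otherCycleMins.1 hs).1 m hms.symm) (hm s hms)
  · rintro rfl
    exact hjm

theorem cdetTerm_mul_swap (hB : ∀ p, B p i = B p j) (h : ¬σ.SameCycle i j) {m : Fin n}
    (hjm : σ.SameCycle j m) (hm : ∀ t, σ.SameCycle m t → m ≤ t) :
    cdetTerm B i (σ * swap i j) =
      (((otherCycleMins σ i).erase m).reverse.map (colCycleProd B σ)).prod *
        (colCycleProd B σ i * colCycleProd B σ j) := by
  rw [cdetTerm, colCycleProd_mul_swap h hB, ← otherCycleMins_mul_swap h hjm hm]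
  congr 2
  refine List.map_congr_left fun s hs => ?_
  rw [List.mem_reverse, mem_otherCycleMins_mul_swap h, mem_otherCycleMins] at hs
  exact colCycleProd_congr (mul_swap_apply_eq_of_not_sameCycle hs.1.2 hs.2)

theorem otherCycleMins_invCycle : otherCycleMins (invCycle j σ) i = otherCycleMins σ i := by
  simp only [otherCycleMins, sameCycle_invCycle]

theorem colCycleProd_invCycle_of_not_sameCycle {s : Fin n} (h : ¬σ.SameCycle j s) :
    colCycleProd B (invCycle j σ) s = colCycleProd B σ s :=
  colCycleProd_congr (invCycle_pow_apply_of_not_sameCycle h)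

theorem colCycleProd_invCycle_of_sameCycle (hB : ∀ p ≠ i, ∀ q ≠ i, star (B p q) = B q p)
    (h : ¬σ.SameCycle i j) {s : Fin n} (hs : σ.SameCycle j s) :
    colCycleProd B (invCycle j σ) s = star (colCycleProd B σ s) := by
  have hne : ∀ k : ℕ, (σ ^ k) s ≠ i := fun k e =>
    h ((sameCycle_pow_right.2 hs : σ.SameCycle j ((σ ^ k) s)).trans (e ▸ SameCycle.refl _ _)).symm
  rw [colCycleProd_congr (invCycle_pow_apply_of_sameCycle hs)]
  exact colCycleProd_inv fun k => hB _ (hne _) _ (hne _)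

/-- The four terms obtained from `σ` by inverting its cycle through `j` and by joining its cycles
through `i` and `j` cancel. -/
theorem cdetTerm_add_invCycle (hB : ∀ p, B p i = B p j)
    (hB' : ∀ p ≠ i, ∀ q ≠ i, star (B p q) = B q p) (h : ¬σ.SameCycle i j) :
    cdetTerm B i σ + cdetTerm B i (invCycle j σ) =
      cdetTerm B i (σ * swap i j) + cdetTerm B i (invCycle j σ * swap i j) := by
  obtain ⟨m, hjm, hm⟩ := exists_cycle_min σ j
  have hji : ¬σ.SameCycle j i := fun e => h e.symm
  have hl : (otherCycleMins σ i).Nodup := Finset.sort_nodup _ _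
  have hmem : m ∈ otherCycleMins σ i :=
    mem_otherCycleMins.2 ⟨hm, fun e => h (e.trans hjm.symm)⟩
  have hother : ∀ s ∈ otherCycleMins σ i, s ≠ m →
      colCycleProd B (invCycle j σ) s = colCycleProd B σ s := by
    intro s hs hsm
    refine colCycleProd_invCycle_of_not_sameCycle fun hjs => hsm ?_
    have hms := hjm.symm.trans hjs
    exact le_antisymm ((mem_otherCycleMins.1 hs).1 m hms.symm) (hm s hms)
  rw [cdetTerm_mul_swap hB h hjm hm, cdetTerm_mul_swap (σ := invCycle j σ) hB
    (mt sameCycle_invCycle.1 h) (sameCycle_invCycle.2 hjm) fun t ht => hm t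
      (sameCycle_invCycle.1 ht)]
  simp only [cdetTerm, otherCycleMins_invCycle, colCycleProd_invCycle_of_not_sameCycle hji]
  have herase : ((otherCycleMins σ i).erase m).reverse.map (colCycleProd B (invCycle j σ)) =
      ((otherCycleMins σ i).erase m).reverse.map (colCycleProd B σ) :=
    List.map_congr_left fun s hs => by
      rw [List.mem_reverse, hl.mem_erase_iff] at hs
      exact hother s hs.2 hs.1
  have hc : ∀ x : SplitQuaternion,
      Commute ((2 * (colCycleProd B σ j).re : ℝ) : SplitQuaternion) x :=
    fun x => QuaternionAlgebra.coe_commute _ x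
  rw [herase, colCycleProd_invCycle_of_sameCycle hB' h (SameCycle.refl _ _), ← mul_add,
    ← mul_add, add_star_eq_coe_re, ← add_mul,
    prod_reverse_map_add_of_mem hmem hl hc hother ?_, mul_assoc, (hc _).eq]
  rw [colCycleProd_invCycle_of_sameCycle hB' h hjm, add_star_eq_coe_re,
    re_colCycleProd_eq_of_sameCycle hjm]

theorem cdet_eq_zero_of_col_eq (hij : i ≠ j) (hB : ∀ p, B p i = B p j)
    (hB' : ∀ p ≠ i, ∀ q ≠ i, star (B p q) = B q p) : cdet B i = 0 := by
  classical
  set T : Perm (Fin n) → SplitQuaternion :=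
    fun σ => ((sign σ : ℤ) : SplitQuaternion) * cdetTerm B i σ with hT
  set D : Finset (Perm (Fin n)) := Finset.univ.filter fun σ => ¬σ.SameCycle i j with hD
  have hmemD : ∀ {σ}, σ ∈ D ↔ ¬σ.SameCycle i j := by simp [hD]
  have hsplit : cdet B i = ∑ σ ∈ D, (T σ + T (σ * swap i j)) := by
    have hjoin : ∑ σ ∈ D, T (σ * swap i j) = ∑ σ with ¬¬σ.SameCycle i j, T σ := by
      refine Finset.sum_bij' (fun σ _ => σ * swap i j) (fun σ _ => σ * swap i j) ?_ ?_ ?_ ?_ ?_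
      · intro σ hσ
        simpa using sameCycle_mul_swap (hmemD.1 hσ)
      · intro σ hσ
        exact hmemD.2 (not_sameCycle_mul_swap hij (by simpa using hσ))
      · simp [mul_assoc]
      · simp [mul_assoc]
      · simp
    rw [Finset.sum_add_distrib, hjoin, hD, Finset.sum_filter_add_sum_filter_not]
    rfl
  have hrev : ∑ σ ∈ D, (T σ + T (σ * swap i j)) =
      ∑ σ ∈ D, (T (invCycle j σ) + T (invCycle j σ * swap i j)) := by
    refine Finset.sum_bij' (fun σ _ => invCycle j σ) (fun σ _ => invCycle j σ) ?_ ?_ ?_ ?_ ?_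
    · intro σ hσ
      exact hmemD.2 (mt sameCycle_invCycle.1 (hmemD.1 hσ))
    · intro σ hσ
      exact hmemD.2 (mt sameCycle_invCycle.1 (hmemD.1 hσ))
    · simp [invCycle_invCycle]
    · simp [invCycle_invCycle]
    · simp [invCycle_invCycle]
  have hzero : cdet B i + cdet B i = 0 := by
    nth_rewrite 2 [hsplit]
    rw [hrev, hsplit, ← Finset.sum_add_distrib]
    refine Finset.sum_eq_zero fun σ hσ => ?_
    have key := cdetTerm_add_invCycle hB hB' (hmemD.1 hσ)
    simp only [hT, Perm.sign_mul, sign_invCycle, sign_swap hij]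
    push_cast
    have hs := congrArg (((sign σ : ℤ) : SplitQuaternion) * ·) (sub_eq_zero.2 key)
    simp only [mul_sub, mul_add, mul_zero] at hs
    rw [← hs]
    simp only [mul_neg, mul_one, neg_mul]
    abel
  rw [← two_smul ℝ] at hzero
  exact (smul_eq_zero.1 hzero).resolve_left two_ne_zero

end Cancellation

/-- If the `i`-th column of a Hermitian matrix `A` is replaced with its `j`-th
column, `i ≠ j`, then the `i`-th column determinant of the resulting matrix
vanishes. -/
theorem cdet_updateColumn_eq_zero_of_isHermitian (A : Matrix (Fin n) (Fin n) SplitQuaternion)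
    (hA : A.IsHermitian) (i j : Fin n) (hij : i ≠ j) :
    cdet (A.updateCol i (fun p => A p j)) i = 0 := by
  refine cdet_eq_zero_of_col_eq hij (fun p => ?_) fun p hp q hq => ?_
  · simp [hij.symm]
  · rw [Matrix.updateCol_ne hq, Matrix.updateCol_ne hp]
    exact hA.apply q p

end SplitQuaternion

end
end
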